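/- In the product case (α = β = 0), for every maximal exceptional sequence s at least one of the following holds: (i) s is vertically orderable and H(s) ≤ 2ℓ₂ − 1; (ii) s is horizontally orderable and W(s) ≤ 2ℓ₁ − 1. -/

import Mathlib

/-- The immaculate locus `I(ℓ₁,ℓ₂;α,β) ⊆ ℤ²`: union of the horizontal strip
`𝓗 = {(a,b) : 0 < b < ℓ₂}` and the parallelogram
`𝓟 = {(a,b) : −β < a < ℓ₁ and 0 < a + αb < ℓ₁ − β + αℓ₂}`. -/
def Imm (l1 l2 α β : ℤ) : Set (ℤ × ℤ) :=
  {p | (0 < p.2 ∧ p.2 < l2) ∨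
    (-β < p.1 ∧ p.1 < l1 ∧ 0 < p.1 + α * p.2 ∧ p.1 + α * p.2 < l1 - β + α * l2)}

/-- A finite sequence `s₀, …, s_N` in `ℤ²` is exceptional if `s_j − s_i ∈ I`
for all `0 ≤ i < j ≤ N`. -/
def Exceptional (l1 l2 α β : ℤ) {N : ℕ} (s : Fin (N + 1) → ℤ × ℤ) : Prop :=
  ∀ i j : Fin (N + 1), i < j → s j - s i ∈ Imm l1 l2 α β

/-- Vertical lexicographic order on `ℤ²`. -/
def vlex (p q : ℤ × ℤ) : Prop := p.2 < q.2 ∨ (p.2 = q.2 ∧ p.1 < q.1)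

/-- Horizontal lexicographic order on `ℤ²`. -/
def hlex (p q : ℤ × ℤ) : Prop := p.1 < q.1 ∨ (p.1 = q.1 ∧ p.2 < q.2)

/-- An exceptional sequence is vertically orderable if listing its underlying set
in the vertical lexicographic order again yields an exceptional sequence. -/
def VertOrderable (l1 l2 α β : ℤ) {N : ℕ} (s : Fin (N + 1) → ℤ × ℤ) : Prop :=
  ∀ p ∈ Set.range s, ∀ q ∈ Set.range s, vlex p q → q - p ∈ Imm l1 l2 α β

/-- Horizontally orderable: as above with the roles of the coordinates exchanged. -/
def HorOrderable (l1 l2 α β : ℤ) {N : ℕ} (s : Fin (N + 1) → ℤ × ℤ) : Prop :=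
  ∀ p ∈ Set.range s, ∀ q ∈ Set.range s, hlex p q → q - p ∈ Imm l1 l2 α β

/-- Height `H(s) = (max b) − (min b) + 1` of a sequence in `ℤ²`. -/
noncomputable def heightSeq {N : ℕ} (s : Fin (N + 1) → ℤ × ℤ) : ℤ :=
  (Finset.univ.sup' Finset.univ_nonempty fun i => (s i).2) -
    (Finset.univ.inf' Finset.univ_nonempty fun i => (s i).2) + 1

/-- Width `W(s) = (max a) − (min a) + 1` of a sequence in `ℤ²`. -/
noncomputable def widthSeq {N : ℕ} (s : Fin (N + 1) → ℤ × ℤ) : ℤ :=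
  (Finset.univ.sup' Finset.univ_nonempty fun i => (s i).1) -
    (Finset.univ.inf' Finset.univ_nonempty fun i => (s i).1) + 1

/-- The lattice `L = ℤ·(ℓ₁,0) ⊕ ℤ·(−β,ℓ₂) ⊆ ℤ²`. -/
def ImmLat (l1 l2 β : ℤ) : Set (ℤ × ℤ) := {p | ∃ m n : ℤ, p = (m * l1 - n * β, n * l2)}

/-- The relation between the points `(a, b)` and `(c, d)` at positions `i` and `j` of an exceptional
sequence in the product case. -/
def ExcPair (l1 l2 i a b j c d : ℤ) : Prop :=
  (i < j ∧ 0 < d - b ∧ d - b < l2) ∨ (i < j ∧ 0 < c - a ∧ c - a < l1) ∨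
  (j < i ∧ 0 < b - d ∧ b - d < l2) ∨ (j < i ∧ 0 < a - c ∧ a - c < l1) ∨
  (i = j ∧ a = c ∧ b = d)

lemma excPair_of_exceptional {l1 l2 : ℤ} {N : ℕ} {s : Fin (N + 1) → ℤ × ℤ}
    (hs : Exceptional l1 l2 0 0 s) (i j : Fin (N + 1)) :
    ExcPair l1 l2 i (s i).1 (s i).2 j (s j).1 (s j).2 := by
  unfold ExcPair
  rcases lt_trichotomy i j with h | h | h
  · have hI := hs i j h
    simp only [Imm, Set.mem_ofPred_eq, Prod.fst_sub, Prod.snd_sub] at hI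
    have : (i : ℕ) < j := h
    omega
  · subst h
    simp
  · have hI := hs j i h
    simp only [Imm, Set.mem_ofPred_eq, Prod.fst_sub, Prod.snd_sub] at hI
    have : (j : ℕ) < i := h
    omega

/-- A pair of points obstructing the vertical alternative cannot coexist with a pair obstructing
the horizontal one. -/
lemma not_vertical_and_horizontal_obstruction
    {l1 l2 i a b j c d k e f m g h : ℤ} (hl1 : 2 ≤ l1) (hl2 : 2 ≤ l2)
    (h12 : ExcPair l1 l2 i a b j c d) (h34 : ExcPair l1 l2 k e f m g h)
    (h13 : ExcPair l1 l2 i a b k e f) (h14 : ExcPair l1 l2 i a b m g h)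
    (h23 : ExcPair l1 l2 j c d k e f) (h24 : ExcPair l1 l2 j c d m g h)
    (hV : l2 ≤ d - b ∧ (c < a ∨ 2 * l2 - 1 ≤ d - b))
    (hH : l1 ≤ g - e ∧ (h < f ∨ 2 * l1 - 1 ≤ g - e)) : False := by
  unfold ExcPair at *
  omega

lemma exists_vertical_obstruction {l1 l2 : ℤ} {N : ℕ} {s : Fin (N + 1) → ℤ × ℤ}
    (hs : Exceptional l1 l2 0 0 s) (hl2 : 2 ≤ l2)
    (hV : ¬ (VertOrderable l1 l2 0 0 s ∧ heightSeq s ≤ 2 * l2 - 1)) :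
    ∃ i j, l2 ≤ (s j).2 - (s i).2 ∧
      ((s j).1 < (s i).1 ∨ 2 * l2 - 1 ≤ (s j).2 - (s i).2) := by
  by_contra! hno
  refine hV ⟨?_, ?_⟩
  · rintro _ ⟨i, rfl⟩ _ ⟨j, rfl⟩ hij
    have hp := excPair_of_exceptional hs i j
    have h' := hno i j
    simp only [Imm, vlex, ExcPair, Set.mem_ofPred_eq, Prod.fst_sub, Prod.snd_sub] at *
    omega
  · obtain ⟨j, -, hj⟩ := Finset.exists_mem_eq_sup' (Finset.univ_nonempty (α := Fin (N + 1)))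
      fun i => (s i).2
    obtain ⟨i, -, hi⟩ := Finset.exists_mem_eq_inf' (Finset.univ_nonempty (α := Fin (N + 1)))
      fun i => (s i).2
    have h' := hno i j
    rw [heightSeq, hi, hj]
    omega

lemma exists_horizontal_obstruction {l1 l2 : ℤ} {N : ℕ} {s : Fin (N + 1) → ℤ × ℤ}
    (hs : Exceptional l1 l2 0 0 s) (hl1 : 2 ≤ l1)
    (hH : ¬ (HorOrderable l1 l2 0 0 s ∧ widthSeq s ≤ 2 * l1 - 1)) :
    ∃ i j, l1 ≤ (s j).1 - (s i).1 ∧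
      ((s j).2 < (s i).2 ∨ 2 * l1 - 1 ≤ (s j).1 - (s i).1) := by
  by_contra! hno
  refine hH ⟨?_, ?_⟩
  · rintro _ ⟨i, rfl⟩ _ ⟨j, rfl⟩ hij
    have hp := excPair_of_exceptional hs i j
    have h' := hno i j
    simp only [Imm, hlex, ExcPair, Set.mem_ofPred_eq, Prod.fst_sub, Prod.snd_sub] at *
    omega
  · obtain ⟨j, -, hj⟩ := Finset.exists_mem_eq_sup' (Finset.univ_nonempty (α := Fin (N + 1)))
      fun i => (s i).1
    obtain ⟨i, -, hi⟩ := Finset.exists_mem_eq_inf' (Finset.univ_nonempty (α := Fin (N + 1)))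
      fun i => (s i).1
    have h' := hno i j
    rw [widthSeq, hi, hj]
    omega

/-- dichotomy for maximal exceptional sequences in the product case. -/
theorem stmt_15 (l1 l2 : ℤ) (hl1 : 2 ≤ l1) (hl2 : 2 ≤ l2)
    (N : ℕ) (hN : (N : ℤ) + 1 = l1 * l2)
    (s : Fin (N + 1) → ℤ × ℤ) (hs : Exceptional l1 l2 0 0 s) :
    (VertOrderable l1 l2 0 0 s ∧ heightSeq s ≤ 2 * l2 - 1) ∨
    (HorOrderable l1 l2 0 0 s ∧ widthSeq s ≤ 2 * l1 - 1) := by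
  by_contra hno
  obtain ⟨hV, hH⟩ := not_or.mp hno
  obtain ⟨i, j, hV⟩ := exists_vertical_obstruction hs hl2 hV
  obtain ⟨k, m, hH⟩ := exists_horizontal_obstruction hs hl1 hH
  have hp := excPair_of_exceptional hs
  exact not_vertical_and_horizontal_obstruction hl1 hl2 (hp i j) (hp k m) (hp i k) (hp i m)
    (hp j k) (hp j m) hV hH
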